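/- Let M be a toric monoid and v ∈ M. Then v is not contained in any facet of M if and only if v lies in every nonempty prime ideal of M. -/

import Mathlib

open scoped TensorProduct Pointwise

/-- The rank of an abelian group `A`, i.e. `dim_ℚ (A ⊗_ℤ ℚ)`, for a subgroup of an ambient
abelian group. -/
noncomputable def grpRank {G : Type*} [AddCommGroup G] (A : AddSubgroup G) : ℕ :=
  Module.finrank ℚ (ℚ ⊗[ℤ] A)

variable {Λ : Type*} [AddCommGroup Λ]

/-- The rank of the subgroup generated by a subset `S` of `Λ`. -/
noncomputable def setRank (S : Set Λ) : ℕ :=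
  grpRank (AddSubgroup.closure S)

/-- The rank of a submonoid `M` of `Λ`; when `Λ = M^gp` this is `rk M = dim_ℚ(M^gp ⊗ ℚ)`. -/
noncomputable def monRank (M : AddSubmonoid Λ) : ℕ :=
  setRank (M : Set Λ)

/-- A toric monoid, presented as a submonoid `M` of an abelian group `Λ` which plays the role
of `M^gp`: `M` is finitely generated (hence fine, being cancellative as a submonoid of a
group), `M` generates `Λ` as a group (so that `Λ = M^gp`), `Λ` is torsion free, and `M`
is saturated in `Λ`. -/
def IsToric (M : AddSubmonoid Λ) : Prop :=
  M.FG ∧ AddSubgroup.closure (M : Set Λ) = ⊤ ∧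
    (∀ (x : Λ) (n : ℕ), 0 < n → n • x = 0 → x = 0) ∧
    (∀ (x : Λ) (n : ℕ), 0 < n → n • x ∈ M → x ∈ M)

/-- `M` is sharp: `0` is its only unit. -/
def IsSharp (M : AddSubmonoid Λ) : Prop :=
  ∀ x ∈ M, ∀ y ∈ M, x + y = 0 → x = 0

/-- An ideal of the monoid `M`: a subset `I ⊆ M` with `I + M ⊆ I`. -/
def IsMonIdeal (M : AddSubmonoid Λ) (I : Set Λ) : Prop :=
  I ⊆ (M : Set Λ) ∧ ∀ i ∈ I, ∀ m ∈ M, i + m ∈ I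

/-- A prime ideal of the monoid `M`: an ideal `p ≠ M` such that `x + y ∈ p` implies `x ∈ p` or
`y ∈ p`.  The empty set counts as a prime ideal. -/
def IsPrimeMonIdeal (M : AddSubmonoid Λ) (p : Set Λ) : Prop :=
  IsMonIdeal M p ∧ p ≠ (M : Set Λ) ∧ ∀ x ∈ M, ∀ y ∈ M, x + y ∈ p → x ∈ p ∨ y ∈ p

/-- The height of a prime ideal `p` of `M`: the supremum (in `ℕ∞`) of the lengths `n` of chains
`p₀ ⊊ p₁ ⊊ ⋯ ⊊ pₙ = p` of prime ideals of `M`. -/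
noncomputable def primeHeight (M : AddSubmonoid Λ) (p : Set Λ) : ℕ∞ :=
  sSup {n : ℕ∞ | ∃ m : ℕ, n = (m : ℕ∞) ∧ ∃ c : Fin (m + 1) → Set Λ,
    (∀ i, IsPrimeMonIdeal M (c i)) ∧ StrictMono c ∧ c (Fin.last m) = p}

/-- A face of the monoid `M`: a submonoid `F ⊆ M` such that `x + y ∈ F` implies `x ∈ F` and
`y ∈ F` for `x, y ∈ M`. -/
def IsFace (M : AddSubmonoid Λ) (F : Set Λ) : Prop :=
  F ⊆ (M : Set Λ) ∧ 0 ∈ F ∧ (∀ x ∈ F, ∀ y ∈ F, x + y ∈ F) ∧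
    ∀ x ∈ M, ∀ y ∈ M, x + y ∈ F → x ∈ F ∧ y ∈ F

/-- A facet of `M`: a face of rank `rk(M) - 1`. -/
def IsFacet (M : AddSubmonoid Λ) (F : Set Λ) : Prop :=
  IsFace M F ∧ (setRank F : ℤ) = (monRank M : ℤ) - 1

/-- An edge of `M`: a face of rank `1`. -/
def IsEdge (M : AddSubmonoid Λ) (E : Set Λ) : Prop :=
  IsFace M E ∧ setRank E = 1

/-- The face `N` splits off from `M`: there is a face `K` such that the addition map
`N × K → M` is bijective. -/
def SplitsOff (M : AddSubmonoid Λ) (N : Set Λ) : Prop :=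
  ∃ K : Set Λ, IsFace M K ∧
    (∀ m ∈ M, ∃ a ∈ N, ∃ b ∈ K, m = a + b) ∧
    (∀ a ∈ N, ∀ b ∈ K, ∀ a' ∈ N, ∀ b' ∈ K, a + b = a' + b' → a = a' ∧ b = b')

/-- A linear functional on a finitely generated abelian group detects any non-torsion element. -/
theorem exists_dual_ne_zero {G : Type*} [AddCommGroup G] [Module.Finite ℤ G] {b : G}
    (hb : ∀ a : ℤ, a ≠ 0 → a • b ≠ 0) : ∃ f : G →ₗ[ℤ] ℤ, f b ≠ 0 := by
  by_contra! h
  let B := Module.Free.chooseBasis ℤ (G ⧸ Submodule.torsion ℤ G)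
  have hb0 : (Submodule.torsion ℤ G).mkQ b = 0 :=
    B.ext_elem fun i => by
      simpa using h ((B.coord i).comp (Submodule.torsion ℤ G).mkQ)
  rw [Submodule.mkQ_apply, Submodule.Quotient.mk_eq_zero, Submodule.mem_torsion_iff] at hb0
  obtain ⟨a, ha⟩ := hb0
  exact hb a (nonZeroDivisors.ne_zero a.2) ha

/-- **Farkas lemma** over `ℤ`: if no positive multiple of `b` lies in the monoid generated by finitely
many elements, some functional is nonnegative on these and negative on `b`. -/
theorem exists_dual_nonneg_of_nsmul_notMem_closure {G ι : Type*} [AddCommGroup G]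
    [Module.Finite ℤ G] (s : Finset ι) : ∀ (u : ι → G) (b : G),
    (∀ k : ℕ, 0 < k → k • b ∉ AddSubmonoid.closure (u '' s)) →
    ∃ f : G →ₗ[ℤ] ℤ, (∀ i ∈ s, 0 ≤ f (u i)) ∧ f b < 0 := by
  classical
  induction s using Finset.induction_on with
  | empty =>
    intro u b hb
    have hb' : ∀ a : ℤ, a ≠ 0 → a • b ≠ 0 := by
      intro a ha h0
      refine hb a.natAbs (Int.natAbs_pos.2 ha) ?_
      rw [← natCast_zsmul, Int.natCast_natAbs]
      rcases abs_choice a with h | h <;> simp [h, h0]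
    obtain ⟨f, hf⟩ := exists_dual_ne_zero hb'
    rcases lt_or_gt_of_ne hf with h | h
    · exact ⟨f, by simp, h⟩
    · exact ⟨-f, by simp, by simpa using h⟩
  | insert j s _ ih =>
    intro u b hb
    obtain ⟨f, hf, hfb⟩ := ih u b fun k hk h => hb k hk <|
      AddSubmonoid.closure_mono (Set.image_mono (by simp)) h
    rcases le_or_gt 0 (f (u j)) with hj | hj
    · exact ⟨f, by simpa using ⟨hj, hf⟩, hfb⟩
    let p : G →ₗ[ℤ] G := (-f (u j)) • LinearMap.id + f.smulRight (u j)
    have hp : ∀ x, p x = (-f (u j)) • x + f x • u j := fun x => by simp [p]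
    obtain ⟨g, hg, hgb⟩ := ih (p ∘ u) (p b) (by
      intro k hk hmem
      have hmap : (p ∘ u) '' s = p.toAddMonoidHom '' (u '' s) := by
        rw [Set.image_comp]; rfl
      rw [hmap, ← AddMonoidHom.map_mclosure] at hmem
      obtain ⟨z, hz, hzb⟩ := hmem
      have hz0 : 0 ≤ f z := by
        have hle : AddSubmonoid.closure (u '' s) ≤
            (AddSubmonoid.nonneg ℤ).comap f.toAddMonoidHom := by
          rw [AddSubmonoid.closure_le]
          rintro _ ⟨i, hi, rfl⟩
          exact hf i hi
        exact hle hz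
      have hpz : p z = k • p b := hzb
      rw [hp, hp] at hpz
      have hkey : (k * (-f (u j)).toNat) • b =
          (-f (u j)).toNat • z + (f z - k * f b).toNat • u j := by
        have hd : 0 ≤ f z - k * f b := by
          have := mul_nonpos_of_nonneg_of_nonpos (Int.natCast_nonneg k) hfb.le
          omega
        simp only [← natCast_zsmul, Nat.cast_mul, Int.toNat_of_nonneg hd,
          Int.toNat_of_nonneg (neg_nonneg.2 hj.le)] at hpz ⊢
        rw [sub_smul, ← sub_eq_zero]
        rw [← sub_eq_zero] at hpz
        rw [← neg_eq_zero, ← hpz]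
        module
      refine hb (k * (-f (u j)).toNat) (Nat.mul_pos hk (by omega)) ?_
      rw [hkey]
      refine add_mem (nsmul_mem (AddSubmonoid.closure_mono (Set.image_mono (by simp)) hz) _)
        (nsmul_mem (AddSubmonoid.subset_closure (Set.mem_image_of_mem u (by simp))) _))
    refine ⟨g.comp p, ?_, hgb⟩
    have : p (u j) = 0 := by rw [hp]; simp
    simpa [this] using hg

/-- A subgroup of smaller rank lies in the kernel of a nonzero functional. -/
theorem exists_dual_ne_zero_of_finrank_lt {G : Type*} [AddCommGroup G] [Module.Finite ℤ G]
    {A : Submodule ℤ G} (hA : Module.finrank ℤ A < Module.finrank ℤ G) :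
    ∃ g : G →ₗ[ℤ] ℤ, g ≠ 0 ∧ ∀ a ∈ A, g a = 0 := by
  have h := Submodule.finrank_quotient_add_finrank A
  have h0 : Module.finrank ℤ (G ⧸ A) ≠ 0 := by omega
  rw [Ne, Module.finrank_eq_zero_iff] at h0
  push Not at h0
  obtain ⟨x, hx⟩ := h0
  obtain ⟨f, hf⟩ := exists_dual_ne_zero hx
  obtain ⟨x, rfl⟩ := A.mkQ_surjective x
  refine ⟨f.comp A.mkQ, fun h => hf (by simpa using LinearMap.congr_fun h x), fun a ha => ?_⟩
  simp [(Submodule.Quotient.mk_eq_zero A).2 ha]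

theorem finrank_sup_span_singleton_le {G : Type*} [AddCommGroup G] [Module.Finite ℤ G]
    (A : Submodule ℤ G) (w : G) :
    Module.finrank ℤ ↥(A ⊔ Submodule.span ℤ {w}) ≤ Module.finrank ℤ A + 1 := by
  have h1 : Module.finrank ℤ (Submodule.span ℤ {w}) ≤ 1 := by
    simpa using finrank_span_le_card (R := ℤ) ({w} : Set G)
  have h2 := Submodule.rank_add_le_rank_add_rank A (Submodule.span ℤ {w})
  simp only [← Module.finrank_eq_rank] at h2
  norm_cast at h2
  omega

theorem grpRank_eq_finrank {G : Type*} [AddCommGroup G] [Module.Finite ℤ G]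
    [Module.IsTorsionFree ℤ G] (A : AddSubgroup G) :
    grpRank A = Module.finrank ℤ (AddSubgroup.toIntSubmodule A) :=
  Module.finrank_baseChange (R := ℚ) (S := ℤ) (M' := AddSubgroup.toIntSubmodule A)

theorem monRank_eq_finrank [Module.Finite ℤ Λ] [Module.IsTorsionFree ℤ Λ] {M : AddSubmonoid Λ}
    (hM : AddSubgroup.closure (M : Set Λ) = ⊤) : monRank M = Module.finrank ℤ Λ := by
  rw [monRank, setRank, hM, grpRank_eq_finrank]
  exact finrank_top ℤ Λ

namespace IsFace

variable {M : AddSubmonoid Λ} {F : Set Λ}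

theorem mem_of_nsmul_mem (hF : IsFace M F) {x : Λ} (hx : x ∈ M) {k : ℕ} (hk : 0 < k)
    (h : k • x ∈ F) : x ∈ F := by
  obtain ⟨k, rfl⟩ := Nat.exists_eq_succ_of_ne_zero hk.ne'
  rw [Nat.succ_eq_add_one, succ_nsmul] at h
  exact (hF.2.2.2 _ (AddSubmonoid.nsmul_mem _ hx k) _ hx h).2

theorem mem_of_add_mem_left (hF : IsFace M F) {x y : Λ} (hx : x ∈ M) (hy : y ∈ M)
    (h : x + y ∈ F) : x ∈ F :=
  (hF.2.2.2 x hx y hy h).1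

/-- Every element of the group generated by a face is a difference of elements of the face. -/
theorem exists_add_mem_of_mem_closure (hF : IsFace M F) {x : Λ}
    (hx : x ∈ AddSubgroup.closure F) : ∃ y ∈ F, x + y ∈ F := by
  induction hx using AddSubgroup.closure_induction with
  | mem x hx => exact ⟨0, hF.2.1, by simpa using hx⟩
  | zero => exact ⟨0, hF.2.1, by simpa using hF.2.1⟩
  | add x y _ _ hx hy =>
    obtain ⟨a, ha, hxa⟩ := hx
    obtain ⟨b, hb, hyb⟩ := hy
    exact ⟨a + b, hF.2.2.1 a ha b hb, by
      rw [add_add_add_comm]; exact hF.2.2.1 _ hxa _ hyb⟩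
  | neg x _ hx =>
    obtain ⟨a, ha, hxa⟩ := hx
    exact ⟨x + a, hxa, by simpa using ha⟩

theorem mem_of_mem_closure (hF : IsFace M F) {x : Λ} (hxM : x ∈ M)
    (hx : x ∈ AddSubgroup.closure F) : x ∈ F := by
  obtain ⟨y, hy, hxy⟩ := hF.exists_add_mem_of_mem_closure hx
  exact hF.mem_of_add_mem_left hxM (hF.1 hy) hxy

theorem subset_of_inter_subset {S F' : Set Λ} (hF : IsFace M F) (hF' : IsFace M F')
    (hS : AddSubmonoid.closure S = M) (h : F ∩ S ⊆ F') : F ⊆ F' := by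
  intro x hxF
  have hxM : x ∈ AddSubmonoid.closure S := hS ▸ hF.1 hxF
  induction hxM using AddSubmonoid.closure_induction with
  | mem x hx => exact h ⟨hxF, hx⟩
  | zero => exact hF'.2.1
  | add x y hx hy ihx ihy =>
    rw [hS] at hx hy
    obtain ⟨h1, h2⟩ := hF.2.2.2 x hx y hy hxF
    exact hF'.2.2.1 x (ihx h1) y (ihy h2)

end IsFace

/-- A finitely generated monoid has finitely many faces. -/
theorem finite_setOf_isFace {M : AddSubmonoid Λ} (hM : M.FG) : {F | IsFace M F}.Finite := by
  obtain ⟨S, hS⟩ := hM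
  refine Set.Finite.of_finite_image (f := fun F => F ∩ (S : Set Λ))
    (S.finite_toSet.finite_subsets.subset ?_) ?_
  · rintro _ ⟨F, -, rfl⟩
    exact Set.inter_subset_right
  · intro F hF F' hF' h
    exact (hF.subset_of_inter_subset hF' hS (h.le.trans Set.inter_subset_left)).antisymm
      (hF'.subset_of_inter_subset hF hS (h.ge.trans Set.inter_subset_left))

/-- The zero locus of a functional that is nonnegative on `M` is a face. -/
theorem isFace_zeroLocus {M : AddSubmonoid Λ} {f : Λ →ₗ[ℤ] ℤ} (hf : ∀ x ∈ M, 0 ≤ f x) :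
    IsFace M {x | x ∈ M ∧ f x = 0} := by
  refine ⟨fun x hx => hx.1, ⟨M.zero_mem, map_zero f⟩, ?_, ?_⟩
  · rintro x ⟨hx, hx0⟩ y ⟨hy, hy0⟩
    exact ⟨M.add_mem hx hy, by rw [map_add, hx0, hy0, add_zero]⟩
  · rintro x hx y hy ⟨-, h⟩
    rw [map_add] at h
    have := hf x hx
    have := hf y hy
    exact ⟨⟨hx, by omega⟩, ⟨hy, by omega⟩⟩

theorem nonneg_of_closure {S : Set Λ} {M : AddSubmonoid Λ} (hS : AddSubmonoid.closure S = M)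
    {f : Λ →ₗ[ℤ] ℤ} (hf : ∀ s ∈ S, 0 ≤ f s) : ∀ x ∈ M, 0 ≤ f x := by
  have hle : AddSubmonoid.closure S ≤ (AddSubmonoid.nonneg ℤ).comap f.toAddMonoidHom :=
    AddSubmonoid.closure_le.2 hf
  exact fun x hx => hle (hS ▸ hx)

/-- A proper face of a finitely generated monoid is separated from any element outside it by a
functional that is nonnegative on the monoid. -/
theorem IsFace.exists_dual_pos [Module.Finite ℤ Λ] {M : AddSubmonoid Λ} (hM : M.FG) {F : Set Λ}
    (hF : IsFace M F) {w : Λ} (hw : w ∈ M) (hwF : w ∉ F) :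
    ∃ f : Λ →ₗ[ℤ] ℤ, (∀ x ∈ M, 0 ≤ f x) ∧ (∀ x ∈ F, f x = 0) ∧ 0 < f w := by
  classical
  obtain ⟨S, hS⟩ := hM
  have hSM : ∀ s ∈ S, s ∈ M := fun s hs => hS ▸ AddSubmonoid.subset_closure hs
  obtain ⟨f, hf, hfw⟩ := exists_dual_nonneg_of_nsmul_notMem_closure
    (S ∪ (S.filter (· ∈ F)).image (fun s => -s)) id (-w) (by
      intro k hk hmem
      have key : ∀ x ∈ AddSubmonoid.closure
          (id '' (↑(S ∪ (S.filter (· ∈ F)).image (fun s => -s)) : Set Λ)),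
          ∃ a ∈ F, x + a ∈ M := by
        intro x hx
        induction hx using AddSubmonoid.closure_induction with
        | mem x hx =>
          simp only [Set.image_id, Finset.coe_union, Finset.coe_image, Set.mem_union,
            Finset.mem_coe, Set.mem_image, Finset.mem_filter] at hx
          rcases hx with hx | ⟨s, ⟨-, hsF⟩, rfl⟩
          · exact ⟨0, hF.2.1, by simpa using hSM x hx⟩
          · exact ⟨s, hsF, by simp⟩
        | zero => exact ⟨0, hF.2.1, by simp⟩
        | add x y _ _ hx hy =>
          obtain ⟨a, ha, hxa⟩ := hx
          obtain ⟨b, hb, hyb⟩ := hy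
          exact ⟨a + b, hF.2.2.1 a ha b hb, by
            rw [add_add_add_comm]; exact M.add_mem hxa hyb⟩
      obtain ⟨a, ha, hm⟩ := key _ hmem
      have hsum : k • w + (k • -w + a) ∈ F := by simpa using ha
      exact hwF (hF.mem_of_nsmul_mem hw hk
        (hF.mem_of_add_mem_left (M.nsmul_mem hw k) hm hsum)))
  have hfM : ∀ x ∈ M, 0 ≤ f x := nonneg_of_closure hS fun s hs => hf s (by simp_all)
  refine ⟨f, hfM, ?_, by simpa using hfw⟩
  refine fun x hx => (hF.subset_of_inter_subset (isFace_zeroLocus hfM) hS ?_ hx).2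
  rintro s ⟨hsF, hs⟩
  refine ⟨hF.1 hsF, le_antisymm ?_ (hfM s (hF.1 hsF))⟩
  have := hf (-s) (Finset.mem_union_right _ (Finset.mem_image_of_mem _ (by simp_all)))
  simpa using this

/-- If `F` is a maximal proper face and `w ∈ M \ F`, then no nonzero functional vanishes on
both `F` and `w`. -/
theorem eq_zero_of_maximal_isFace [Module.Finite ℤ Λ] {M : AddSubmonoid Λ} (hM : M.FG)
    (hgen : AddSubgroup.closure (M : Set Λ) = ⊤) {F : Set Λ}
    (hF : Maximal (fun F => IsFace M F ∧ F ≠ M) F) {w : Λ} (hw : w ∈ M) (hwF : w ∉ F)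
    {g : Λ →ₗ[ℤ] ℤ} (hgF : ∀ x ∈ F, g x = 0) (hgw : g w = 0) : g = 0 := by
  obtain ⟨f, hfM, hfF, hfw⟩ := hF.prop.1.exists_dual_pos hM hw hwF
  obtain ⟨S, hS⟩ := hM
  have hSM : ∀ s ∈ S, s ∈ M := fun s hs => hS ▸ AddSubmonoid.subset_closure hs
  suffices H : ∀ g : Λ →ₗ[ℤ] ℤ, (∀ x ∈ F, g x = 0) → g w = 0 → ∀ s ∈ S, 0 ≤ g s by
    have h1 := nonneg_of_closure hS (H g hgF hgw)
    have h2 := nonneg_of_closure hS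
      (H (-g) (fun x hx => by simp [hgF x hx]) (by simp [hgw]))
    have hker : AddSubgroup.closure (M : Set Λ) ≤ g.toAddMonoidHom.ker := by
      rw [AddSubgroup.closure_le]
      intro x hx
      exact le_antisymm (by simpa using h2 x hx) (h1 x hx)
    ext x
    exact hker (hgen ▸ AddSubgroup.mem_top x)
  clear hgF hgw g
  intro g hgF hgw
  by_contra! hneg
  obtain ⟨s₁, hs₁, hmin⟩ := Set.exists_min_image {s | s ∈ S ∧ g s < 0}
    (fun s => (f s : ℚ) / (-g s : ℤ)) (S.finite_toSet.subset fun s hs => hs.1) hneg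
  have hs₁M := hSM s₁ hs₁.1
  have hs₁g : g s₁ < 0 := hs₁.2
  let h : Λ →ₗ[ℤ] ℤ := (-g s₁) • f + f s₁ • g
  have hh : ∀ x, h x = (-g s₁) * f x + f s₁ * g x := fun x => by simp [h]
  have hhM : ∀ x ∈ M, 0 ≤ h x := by
    refine nonneg_of_closure hS fun s hs => ?_
    rw [hh]
    have hfs := hfM s (hSM s hs)
    have hfs₁ := hfM s₁ hs₁M
    rcases le_or_gt 0 (g s) with hgs | hgs
    · have : 0 ≤ -g s₁ := by omega
      positivity
    · have hle := hmin s ⟨hs, hgs⟩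
      rw [div_le_div_iff₀ (by exact_mod_cast neg_pos.2 hs₁g)
        (by exact_mod_cast neg_pos.2 hgs)] at hle
      have hle' : f s₁ * -g s ≤ f s * -g s₁ := by exact_mod_cast hle
      linarith
  have hface := isFace_zeroLocus hhM
  have hwh : h w ≠ 0 := by
    rw [hh, hgw, mul_zero, add_zero]
    exact (mul_pos (neg_pos.2 hs₁g) hfw).ne'
  have hsub : F ⊆ {x | x ∈ M ∧ h x = 0} := fun x hx =>
    ⟨hF.prop.1.1 hx, by rw [hh, hfF x hx, hgF x hx]; simp⟩
  have hmem : s₁ ∈ F := hF.le_of_ge ⟨hface, fun he => hwh (he.ge hw).2⟩ hsub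
    ⟨hs₁M, by rw [hh]; ring⟩
  exact hs₁g.ne (hgF s₁ hmem)

/-- A maximal proper face of a toric monoid is a facet. -/
theorem isFacet_of_maximal {M : AddSubmonoid Λ} [Module.Finite ℤ Λ] [Module.IsTorsionFree ℤ Λ]
    (hM : M.FG) (hgen : AddSubgroup.closure (M : Set Λ) = ⊤) {F : Set Λ}
    (hF : Maximal (fun F => IsFace M F ∧ F ≠ M) F) : IsFacet M F := by
  have hface := hF.prop.1
  obtain ⟨w, hw, hwF⟩ : ∃ w ∈ M, w ∉ F := by
    by_contra! h
    exact hF.prop.2 (hface.1.antisymm h)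
  refine ⟨hface, ?_⟩
  rw [monRank_eq_finrank hgen, setRank, grpRank_eq_finrank]
  set A := AddSubgroup.toIntSubmodule (AddSubgroup.closure F)
  have hlt : Module.finrank ℤ A < Module.finrank ℤ Λ := by
    have hq := Submodule.finrank_quotient_add_finrank A
    by_contra hle
    obtain ⟨a, ha, haw⟩ := Module.finrank_eq_zero_iff.1
      (show Module.finrank ℤ (Λ ⧸ A) = 0 by omega) (A.mkQ w)
    rw [← map_smul, Submodule.mkQ_apply, Submodule.Quotient.mk_eq_zero] at haw
    have hmem : a.natAbs • w ∈ AddSubgroup.closure F := by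
      rw [← natCast_zsmul, Int.natCast_natAbs]
      rcases abs_choice a with h | h <;> rw [h]
      · exact haw
      · rw [neg_smul]; exact neg_mem haw
    exact hwF (hface.mem_of_nsmul_mem hw (Int.natAbs_pos.2 ha)
      (hface.mem_of_mem_closure (M.nsmul_mem hw _) hmem))
  have hge : Module.finrank ℤ Λ ≤ Module.finrank ℤ A + 1 := by
    refine le_trans ?_ (finrank_sup_span_singleton_le A w)
    by_contra! hlt'
    obtain ⟨g, hg0, hg⟩ := exists_dual_ne_zero_of_finrank_lt hlt'
    exact hg0 (eq_zero_of_maximal_isFace hM hgen hF hw hwF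
      (fun x hx => hg x (Submodule.mem_sup_left (AddSubgroup.subset_closure hx)))
      (hg w (Submodule.mem_sup_right (Submodule.mem_span_singleton_self w))))
  omega

theorem IsFacet.ne {M : AddSubmonoid Λ} {F : Set Λ} (hF : IsFacet M F) : F ≠ M := by
  rintro rfl
  have := hF.2
  rw [monRank] at this
  omega

/-- The complement of a proper face is a prime ideal. -/
theorem IsFace.isPrimeMonIdeal_diff {M : AddSubmonoid Λ} {F : Set Λ} (hF : IsFace M F) :
    IsPrimeMonIdeal M ((M : Set Λ) \ F) := by
  refine ⟨⟨Set.sdiff_subset, fun i hi m hm =>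
    ⟨M.add_mem hi.1 hm, fun h => hi.2 (hF.mem_of_add_mem_left hi.1 hm h)⟩⟩, fun h => ?_, ?_⟩
  · exact (h.ge M.zero_mem).2 hF.2.1
  · rintro x hx y hy ⟨-, hxy⟩
    by_contra! h
    exact hxy (hF.2.2.1 x (not_not.1 fun hn => h.1 ⟨hx, hn⟩) y
      (not_not.1 fun hn => h.2 ⟨hy, hn⟩))

/-- The complement of a prime ideal is a face. -/
theorem IsPrimeMonIdeal.isFace_diff {M : AddSubmonoid Λ} {p : Set Λ} (hp : IsPrimeMonIdeal M p) :
    IsFace M ((M : Set Λ) \ p) := by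
  obtain ⟨⟨hpM, hadd⟩, hne, hprime⟩ := hp
  refine ⟨Set.sdiff_subset, ⟨M.zero_mem, fun h0 => hne (hpM.antisymm fun m hm => ?_)⟩, ?_, ?_⟩
  · simpa using hadd 0 h0 m hm
  · rintro x ⟨hx, hxp⟩ y ⟨hy, hyp⟩
    exact ⟨M.add_mem hx hy, fun h => (hprime x hx y hy h).elim hxp hyp⟩
  · rintro x hx y hy ⟨-, hxy⟩
    exact ⟨⟨hx, fun h => hxy (hadd x h y hy)⟩,
      ⟨hy, fun h => hxy (add_comm y x ▸ hadd y h x hx)⟩⟩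

/-- inner elements. Let `M` be a toric monoid and `v ∈ M`.  Then `v` is
contained in no facet of `M` if and only if `v` lies in every nonempty prime ideal of `M`. -/
theorem statement5 (M : AddSubmonoid Λ) (hM : IsToric M) (v : Λ) (hv : v ∈ M) :
    (∀ F : Set Λ, IsFacet M F → v ∉ F) ↔
    (∀ p : Set Λ, IsPrimeMonIdeal M p → p.Nonempty → v ∈ p) := by
  obtain ⟨hfg, hgen, htors, -⟩ := hM
  constructor
  · intro h p hp hne
    by_contra hvp
    have : Module.Finite ℤ Λ := by
      obtain ⟨S, hS⟩ := hfg
      rw [Module.Finite.iff_addGroup_fg]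
      refine ⟨S, top_unique ?_⟩
      rw [← hgen, AddSubgroup.closure_le, ← hS]
      exact AddSubgroup.le_closure_toAddSubmonoid _
    have : Module.IsTorsionFree ℤ Λ := by
      have : IsAddTorsionFree Λ := by
        refine ⟨fun n hn x y hxy => sub_eq_zero.1 (htors _ n (Nat.pos_of_ne_zero hn) ?_)⟩
        rw [smul_sub]
        exact sub_eq_zero.2 hxy
      infer_instance
    have hproper : (M : Set Λ) \ p ≠ M := fun he => by
      obtain ⟨x, hx⟩ := hne
      exact (he.ge (hp.1.1 hx)).2 hx
    obtain ⟨F, hle, hF⟩ := Set.Finite.exists_le_maximal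
      (s := {F | IsFace M F ∧ F ≠ M}) ((finite_setOf_isFace hfg).subset fun F hF => hF.1)
      ⟨hp.isFace_diff, hproper⟩
    exact h F (isFacet_of_maximal hfg hgen hF) (hle ⟨hv, hvp⟩)
  · intro h F hF hvF
    refine (h _ hF.1.isPrimeMonIdeal_diff ?_).2 hvF
    rw [Set.nonempty_iff_ne_empty, Ne, Set.sdiff_eq_empty]
    exact fun hsub => hF.ne (hF.1.1.antisymm hsub)
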